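/- Let p be odd and n ≥ 1. The p-adic exponential and the partition into residue disks give: for any locally constant function φ on 1+pZ_p constant on cosets of 1+p^nZ_p and any continuous character κ: 1+pZ_p → C_p^× with |κ(exp(p)) − 1| ≤ p^{−p^{−n+1}}, the product φ·κ is locally analytic on 1+pZ_p, analytic on each disk exp(jp) + p^nZ_p (0 ≤ j < p^{n-1}); in particular κ itself is analytic on 1+p^nZ_p. -/

import Mathlib

/-- The `p`-adic exponential `exp(x) = ∑_{n ≥ 0} x^n / n!` (convergent on `pℤ_p` for `p` odd). -/
noncomputable def padicExp {p : ℕ} [Fact p.Prime] (x : ℚ_[p]) : ℚ_[p] :=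
  ∑' n : ℕ, ((n.factorial : ℚ_[p]))⁻¹ * x ^ n

theorem summable_pow_half {r : ℝ} (h0 : 0 ≤ r) (h1 : r < 1) :
    Summable fun k : ℕ => r ^ (k / 2) := by
  have h := summable_geometric_of_lt_one h0 h1
  refine (HasSum.even_add_odd (m := ∑' k, r ^ k) (m' := ∑' k, r ^ k) ?_ ?_).summable
  · simpa using h.hasSum
  · convert h.hasSum using 3
    omega

theorem padicNorm_factorial_inv_mul_le (p : ℕ) [Fact p.Prime] (hodd : p ≠ 2) (k : ℕ) :
    ‖(k.factorial : ℚ_[p])‖⁻¹ * (p : ℝ)⁻¹ ^ k ≤ (p : ℝ)⁻¹ ^ (if k = 0 then 0 else k / 2 + 1) := by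
  have hp := (Fact.out : p.Prime)
  have hp2 : 3 ≤ p := by have := hp.two_le; omega
  have hp0 : (0 : ℝ) < p := by exact_mod_cast hp.pos
  have hp1 : (1 : ℝ) ≤ p := by exact_mod_cast hp.one_le
  rcases eq_or_ne k 0 with rfl | hk
  · simp
  have h1 := sub_one_mul_padicValNat_factorial_lt_of_ne_zero p hk
  have h2 : 2 * padicValNat p k.factorial ≤ (p - 1) * padicValNat p k.factorial :=
    Nat.mul_le_mul_right _ (by omega)
  have hne : (k.factorial : ℚ_[p]) ≠ 0 := by exact_mod_cast k.factorial_ne_zero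
  rw [Padic.norm_eq_zpow_neg_valuation hne, Padic.valuation_natCast, if_neg hk, zpow_neg,
    inv_inv, zpow_natCast]
  generalize padicValNat p k.factorial = v at h1 h2 ⊢
  replace h1 := h2.trans_lt h1
  clear h2 hne
  obtain ⟨w, rfl⟩ : ∃ w, k = v + w := ⟨k - v, by omega⟩
  rw [pow_add, ← mul_assoc, ← mul_pow, mul_inv_cancel₀ hp0.ne', one_pow, one_mul]
  exact pow_le_pow_of_le_one (by positivity) (inv_le_one_of_one_le₀ hp1) (by omega)

theorem padicNorm_factorial_inv_mul_le_half (p : ℕ) [Fact p.Prime] (hodd : p ≠ 2) (k : ℕ) :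
    ‖(k.factorial : ℚ_[p])‖⁻¹ * (p : ℝ)⁻¹ ^ k ≤ (p : ℝ)⁻¹ ^ (k / 2) := by
  refine (padicNorm_factorial_inv_mul_le p hodd k).trans ?_
  have hp1 : (1 : ℝ) ≤ p := by exact_mod_cast (Fact.out : p.Prime).one_le
  refine pow_le_pow_of_le_one (by positivity) (inv_le_one_of_one_le₀ hp1) ?_
  split_ifs <;> omega

/-- Lifting the exponent in `ℤ_[p]`: the norm of `q ^ m - 1` for `q ≡ 1` modulo an odd prime `p`. -/
theorem PadicInt.norm_pow_sub_one {p : ℕ} [Fact p.Prime] (hodd : p ≠ 2) {q : ℤ_[p]}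
    (hq : (p : ℤ_[p]) ∣ q - 1) (m : ℕ) : ‖q ^ m - 1‖ = ‖q - 1‖ * ‖(m : ℤ_[p])‖ := by
  have hp := (Fact.out : p.Prime)
  have hp1 : (1 : ℝ) < p := by exact_mod_cast hp.one_lt
  have dvd_pow (q : ℤ_[p]) (hq : (p : ℤ_[p]) ∣ q - 1) (m : ℕ) : (p : ℤ_[p]) ∣ q ^ m - 1 :=
    hq.trans (sub_one_dvd_pow_sub_one q m)
  have coprime (q : ℤ_[p]) (hq : (p : ℤ_[p]) ∣ q - 1) (m : ℕ) (hm : ¬ p ∣ m) :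
      ‖q ^ m - 1‖ = ‖q - 1‖ := by
    have h1 : ‖(m : ℤ_[p])‖ = 1 :=
      PadicInt.norm_natCast_eq_one_iff.2 ((Nat.Prime.coprime_iff_not_dvd hp).2 hm)
    have h2 : (p : ℤ_[p]) ∣ ∑ i ∈ Finset.range m, q ^ i - m := by
      have : ∑ i ∈ Finset.range m, q ^ i - m = ∑ i ∈ Finset.range m, (q ^ i - 1) := by simp
      rw [this]
      exact Finset.dvd_sum fun i _ => dvd_pow q hq i
    have h3 := (PadicInt.norm_lt_one_iff_dvd _).2 h2
    have h4 : ‖∑ i ∈ Finset.range m, q ^ i‖ = 1 := by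
      have := IsUltrametricDist.norm_add_eq_max_of_norm_ne_norm
        (x := ∑ i ∈ Finset.range m, q ^ i - m) (y := (m : ℤ_[p])) (by rw [h1]; exact h3.ne)
      rw [sub_add_cancel, h1, max_eq_right h3.le] at this
      exact this
    rw [← mul_geom_sum, norm_mul, h4, mul_one]
  have prime (q : ℤ_[p]) (hq : (p : ℤ_[p]) ∣ q - 1) : ‖q ^ p - 1‖ = ‖q - 1‖ * (p : ℝ)⁻¹ := by
    obtain ⟨b, hb⟩ := hq
    have h2 := odd_sq_dvd_geom_sum₂_sub (1 : ℤ_[p]) b (hp.odd_of_ne_two hodd)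
    simp only [← hb, add_sub_cancel, one_pow, mul_one] at h2
    have h3 : ‖∑ i ∈ Finset.range p, q ^ i - p‖ < ‖(p : ℤ_[p])‖ := by
      obtain ⟨e, he⟩ := h2
      rw [he, norm_mul, norm_pow, PadicInt.norm_p]
      have := PadicInt.norm_le_one e
      have h5 : (p : ℝ)⁻¹ < 1 := inv_lt_one_of_one_lt₀ hp1
      have h6 : 0 < (p : ℝ)⁻¹ := by positivity
      nlinarith [mul_pos h6 h6]
    have h4 : ‖∑ i ∈ Finset.range p, q ^ i‖ = (p : ℝ)⁻¹ := by
      have := IsUltrametricDist.norm_add_eq_max_of_norm_ne_norm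
        (x := ∑ i ∈ Finset.range p, q ^ i - p) (y := (p : ℤ_[p])) h3.ne
      rw [sub_add_cancel, max_eq_right h3.le, PadicInt.norm_p] at this
      exact this
    rw [← mul_geom_sum, norm_mul, h4]
  rcases eq_or_ne m 0 with rfl | hm
  · simp
  obtain ⟨e, r, hr, rfl⟩ := Nat.exists_eq_pow_mul_and_not_dvd hm p hp.ne_one
  have hpow : ‖q ^ p ^ e - 1‖ = ‖q - 1‖ * (p : ℝ)⁻¹ ^ e := by
    induction e with
    | zero => simp
    | succ e ih =>
      rw [pow_succ, pow_mul, prime _ (dvd_pow q hq _),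
        ih (mul_ne_zero (pow_ne_zero _ hp.ne_zero) (by rintro rfl; simp at hr)), pow_succ, mul_assoc]
  have h1 : ‖(r : ℤ_[p])‖ = 1 :=
    PadicInt.norm_natCast_eq_one_iff.2 ((Nat.Prime.coprime_iff_not_dvd hp).2 hr)
  rw [pow_mul, coprime _ (dvd_pow q hq _) r hr, hpow, Nat.cast_mul, norm_mul, h1, mul_one,
    Nat.cast_pow, norm_pow, PadicInt.norm_p]

/-- Isometric sequences in `ℤ_[p]` have dense range. -/
theorem PadicInt.denseRange_of_norm_sub_eq {p : ℕ} [Fact p.Prime] {a : ℕ → ℤ_[p]}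
    (ha : ∀ i j : ℕ, ‖a i - a j‖ = ‖(i : ℤ_[p]) - j‖) : DenseRange a := by
  have hp := (Fact.out : p.Prime)
  have key (N : ℕ) (x y : ℤ_[p]) :
      PadicInt.toZModPow N x = PadicInt.toZModPow N y ↔ ‖x - y‖ ≤ (p : ℝ) ^ (-N : ℤ) := by
    rw [PadicInt.norm_le_pow_iff_mem_span_pow, ← PadicInt.ker_toZModPow, RingHom.mem_ker, map_sub,
      sub_eq_zero]
  rw [Metric.denseRange_iff]
  intro x r hr
  obtain ⟨N, hN⟩ := exists_pow_lt_of_lt_one hr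
    (inv_lt_one_of_one_lt₀ (by exact_mod_cast hp.one_lt : (1 : ℝ) < p))
  have : NeZero (p ^ N) := ⟨pow_ne_zero _ hp.ne_zero⟩
  let f : ZMod (p ^ N) → ZMod (p ^ N) := fun i => PadicInt.toZModPow N (a i.val)
  have hf : Function.Injective f := fun i j hij => by
    have h1 := (key N _ _).1 hij
    rw [ha, ← key] at h1
    simpa using h1
  obtain ⟨i, hi⟩ := (Finite.injective_iff_surjective.1 hf) (PadicInt.toZModPow N x)
  refine ⟨i.val, ?_⟩
  have h2 := (key N _ _).1 hi
  rw [dist_eq_norm, norm_sub_rev]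
  refine h2.trans_lt ?_
  simpa using hN

/-- The product form of Cauchy's `q`-binomial theorem, with infinitely many (eventually zero)
terms. -/
theorem hasSum_qNewton {K : Type*} [Field K] [TopologicalSpace K] {q : K} (hq0 : q ≠ 0)
    (hq : ∀ i : ℕ, q ^ (i + 1) ≠ 1) (d : K) (m : ℕ) :
    HasSum (fun k => (∏ i ∈ Finset.range k, (d - q ^ i) / ((q ^ (i + 1) - 1) * q ^ i)) *
      ∏ i ∈ Finset.range k, (q ^ m - q ^ i)) (d ^ m) := by
  set w : ℕ → ℕ → K := fun m k =>
    ∏ i ∈ Finset.range k, (q ^ m - q ^ i) / ((q ^ (i + 1) - 1) * q ^ i) with hw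
  set P : ℕ → K := fun k => ∏ i ∈ Finset.range k, (d - q ^ i) with hP
  have hterm (k : ℕ) : (∏ i ∈ Finset.range k, (d - q ^ i) / ((q ^ (i + 1) - 1) * q ^ i)) *
      ∏ i ∈ Finset.range k, (q ^ m - q ^ i) = w m k * P k := by
    simp only [hw, hP, ← Finset.prod_mul_distrib]
    exact Finset.prod_congr rfl fun i _ => by ring
  have hzero (m k : ℕ) (h : m < k) : w m k = 0 :=
    Finset.prod_eq_zero (Finset.mem_range.2 h) (by simp)
  have hne (i : ℕ) : q ^ (i + 1) - 1 ≠ 0 := sub_ne_zero.2 (hq i)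
  have hshift (m k : ℕ) : w (m + 1) (k + 1) * (q ^ (k + 1) - 1) = (q ^ (m + 1) - 1) * w m k := by
    induction k with
    | zero =>
      have := hne 0
      simp only [zero_add, pow_one] at this
      simp [hw, field]
    | succ k ih =>
      have e1 : w (m + 1) (k + 2) = w (m + 1) (k + 1) *
          ((q ^ (m + 1) - q ^ (k + 1)) / ((q ^ (k + 2) - 1) * q ^ (k + 1))) :=
        Finset.prod_range_succ _ _
      have e2 : w m (k + 1) = w m k * ((q ^ m - q ^ k) / ((q ^ (k + 1) - 1) * q ^ k)) :=
        Finset.prod_range_succ _ _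
      have e3 : w (m + 1) (k + 1) = (q ^ (m + 1) - 1) * w m k / (q ^ (k + 1) - 1) := by
        rw [← ih, mul_div_cancel_right₀ _ (hne k)]
      rw [e1, e2, e3]
      have := hne k
      have := hne (k + 1)
      field_simp
      ring
  have hpascal (m k : ℕ) : w (m + 1) (k + 1) = q ^ (k + 1) * w m (k + 1) + w m k := by
    have e2 : w m (k + 1) = w m k * ((q ^ m - q ^ k) / ((q ^ (k + 1) - 1) * q ^ k)) :=
      Finset.prod_range_succ _ _
    have := hne k
    rw [← mul_left_inj' (hne k), hshift, e2]
    field_simp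
    ring
  have hsum (m : ℕ) : ∑ k ∈ Finset.range (m + 1), w m k * P k = d ^ m := by
    induction m with
    | zero => simp [hw, hP]
    | succ m ih =>
      have h0 (m : ℕ) : w m 0 = 1 := by simp [hw]
      have hPs (k : ℕ) : P (k + 1) = P k * (d - q ^ k) := Finset.prod_range_succ _ _
      have h1 : ∑ k ∈ Finset.range (m + 1), q ^ (k + 1) * w m (k + 1) * P (k + 1) + w m 0 * P 0 =
          ∑ k ∈ Finset.range (m + 1), q ^ k * w m k * P k := by
        have := Finset.sum_range_succ' (fun k => q ^ k * w m k * P k) (m + 1)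
        rw [Finset.sum_range_succ, hzero m (m + 1) (by omega)] at this
        simpa using this.symm
      rw [Finset.sum_range_succ', h0, ← h0 m]
      simp only [hpascal, add_mul, Finset.sum_add_distrib]
      rw [add_right_comm, h1, ← Finset.sum_add_distrib, pow_succ, ← ih, Finset.sum_mul]
      exact Finset.sum_congr rfl fun k _ => by rw [hPs]; ring
  simp only [hterm]
  rw [← hsum m]
  refine hasSum_sum_of_ne_finset_zero fun k hk => ?_
  rw [hzero m k (by simpa using hk), zero_mul]

theorem norm_padicExp_sub_le {p : ℕ} [Fact p.Prime] (hodd : p ≠ 2) {x : ℚ_[p]}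
    (hx : ‖x‖ ≤ (p : ℝ)⁻¹) : ‖padicExp x - 1 - x‖ ≤ (p : ℝ)⁻¹ ^ 2 := by
  have hp := (Fact.out : p.Prime)
  have hr1 : (p : ℝ)⁻¹ < 1 := inv_lt_one_of_one_lt₀ (by exact_mod_cast hp.one_lt)
  have hterm (k : ℕ) : ‖((k.factorial : ℚ_[p]))⁻¹ * x ^ k‖ ≤
      ‖(k.factorial : ℚ_[p])‖⁻¹ * (p : ℝ)⁻¹ ^ k := by
    rw [norm_mul, norm_inv, norm_pow]
    gcongr
  have hs : Summable fun k : ℕ => ((k.factorial : ℚ_[p]))⁻¹ * x ^ k :=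
    .of_norm_bounded (summable_pow_half (by positivity) hr1) fun k =>
      (hterm k).trans (padicNorm_factorial_inv_mul_le_half p hodd k)
  rw [padicExp, ← hs.sum_add_tsum_nat_add 2]
  simp only [Finset.sum_range_succ, Finset.sum_range_zero, Nat.factorial, Nat.cast_one, pow_zero,
    pow_one, inv_one, mul_one, one_mul, zero_add]
  rw [add_sub_right_comm, add_sub_cancel_left, add_sub_cancel_left]
  refine IsUltrametricDist.norm_tsum_le_of_forall_le fun k => ?_
  refine ((hterm (k + 2)).trans (padicNorm_factorial_inv_mul_le p hodd (k + 2))).trans ?_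
  refine pow_le_pow_of_le_one (by positivity) hr1.le ?_
  rw [if_neg (by omega)]
  omega

/-- A convergent series of integral polynomials with null coefficients can be rearranged into a
power series. -/
theorem exists_hasSum_pow_smul {p : ℕ} [Fact p.Prime] {K : Type*} [NormedField K]
    [NormedAlgebra ℚ_[p] K] [CompleteSpace K] [IsUltrametricDist K] {b : ℕ → K}
    (hb : Filter.Tendsto (fun k => ‖b k‖) Filter.atTop (nhds 0)) {Q : ℕ → Polynomial ℤ_[p]}
    (hQ : ∀ k, (Q k).natDegree ≤ k) :
    ∃ c : ℕ → K, ∀ (x : ℤ_[p]) (y : K), HasSum (fun k => (((Q k).eval x : ℤ_[p]) : ℚ_[p]) • b k) y →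
      HasSum (fun i : ℕ => (x : ℚ_[p]) ^ i • c i) y := by
  let f : ℕ × ℕ → K := fun t => (((Q t.1).coeff t.2 : ℤ_[p]) : ℚ_[p]) • b t.1
  have hnull (x : ℤ_[p]) :
      Filter.Tendsto (fun t : ℕ × ℕ => (x : ℚ_[p]) ^ t.2 • f t) Filter.cofinite (nhds 0) := by
    rw [tendsto_zero_iff_norm_tendsto_zero, Metric.tendsto_nhds]
    intro ε hε
    obtain ⟨N, hN⟩ := Filter.eventually_atTop.1 (hb.eventually (gt_mem_nhds hε))
    rw [Filter.eventually_cofinite]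
    refine (((Finset.range N) ×ˢ (Finset.range N) : Finset (ℕ × ℕ)).finite_toSet).subset ?_
    rintro ⟨k, j⟩ hkj
    simp only [Set.mem_ofPred_eq, dist_zero_right, not_lt, f, norm_smul, norm_pow,
      PadicInt.padic_norm_e_of_padicInt] at hkj
    rw [Real.norm_of_nonneg (by positivity)] at hkj
    have h1 : ‖x‖ ^ j * (‖(Q k).coeff j‖ * ‖b k‖) ≤ ‖b k‖ := by
      have h2 : ‖x‖ ^ j ≤ 1 := pow_le_one₀ (norm_nonneg _) (PadicInt.norm_le_one x)
      have h3 := PadicInt.norm_le_one ((Q k).coeff j)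
      calc _ ≤ 1 * (1 * ‖b k‖) := by gcongr
        _ = _ := by simp
    have hk : k < N := by
      by_contra! h
      exact absurd (hN k h) (not_lt.2 (hkj.trans h1))
    have hj : j ≤ k := by
      by_contra! h
      rw [Polynomial.coeff_eq_zero_of_natDegree_lt ((hQ k).trans_lt h)] at hkj
      simp at hkj
      linarith
    simp
    omega
  have hsum (x : ℤ_[p]) : Summable fun t : ℕ × ℕ => (x : ℚ_[p]) ^ t.2 • f t :=
    NonarchimedeanAddGroup.summable_of_tendsto_cofinite_zero (hnull x)
  have hsum1 : Summable f := by simpa using hsum 1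
  refine ⟨fun j => ∑' k, f (k, j), fun x y hy => ?_⟩
  have hS := (hsum x).hasSum
  have hrow (k : ℕ) : HasSum (fun j => (x : ℚ_[p]) ^ j • f (k, j))
      ((((Q k).eval x : ℤ_[p]) : ℚ_[p]) • b k) := by
    have : (((Q k).eval x : ℤ_[p]) : ℚ_[p]) • b k =
        ∑ j ∈ Finset.range (k + 1), (x : ℚ_[p]) ^ j • f (k, j) := by
      rw [Polynomial.eval_eq_sum_range' (Nat.lt_succ_of_le (hQ k)), PadicInt.coe_sum,
        Finset.sum_smul]
      exact Finset.sum_congr rfl fun j _ => by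
        rw [smul_smul, PadicInt.coe_mul, PadicInt.coe_pow, mul_comm]
    rw [this]
    refine hasSum_sum_of_ne_finset_zero fun j hj => ?_
    have : (Q k).coeff j = 0 :=
      Polynomial.coeff_eq_zero_of_natDegree_lt ((hQ k).trans_lt (by simpa using hj))
    simp [f, this]
  rw [hy.unique (hS.prod_fiberwise hrow)]
  refine ((Equiv.prodComm ℕ ℕ).hasSum_iff.2 hS).prod_fiberwise fun j => ?_
  exact ((hsum1.prod_symm.prod_factor j).hasSum.const_smul ((x : ℚ_[p]) ^ j))

theorem norm_pow_prime_sub_one_le {p : ℕ} [Fact p.Prime] {K : Type*} [NormedField K]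
    [NormedAlgebra ℚ_[p] K] [IsUltrametricDist K] (z : K) (hz : ‖z‖ ≤ 1) :
    ‖(1 + z) ^ p - 1‖ ≤ max (p : ℝ)⁻¹ (‖z‖ ^ p) := by
  have hp := (Fact.out : p.Prime)
  have hcast (m : ℕ) : ‖(m : K)‖ = ‖(m : ℚ_[p])‖ := by
    rw [← norm_algebraMap' K (m : ℚ_[p]), map_natCast]
  rw [add_comm, add_pow, Finset.sum_range_succ']
  simp only [one_pow, mul_one, pow_zero, Nat.choose_zero_right, Nat.cast_one, add_sub_cancel_right]
  refine IsUltrametricDist.norm_sum_le_of_forall_le_of_nonneg (by positivity) fun i hi => ?_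
  rw [norm_mul, norm_pow, hcast]
  rcases eq_or_ne (i + 1) p with h | h
  · rw [h]
    simp
  · refine le_max_of_le_left ?_
    have hd : p ∣ p.choose (i + 1) :=
      hp.dvd_choose_self (by omega) (by have := Finset.mem_range.1 hi; omega)
    have h1 : ‖((p.choose (i + 1) : ℕ) : ℚ_[p])‖ ≤ (p : ℝ)⁻¹ := by
      obtain ⟨e, he⟩ := hd
      rw [he, Nat.cast_mul, norm_mul, Padic.norm_p]
      exact mul_le_of_le_one_right (by positivity) (IsUltrametricDist.norm_natCast_le_one _ e)
    calc _ ≤ 1 * (p : ℝ)⁻¹ := by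
            gcongr
            exact pow_le_one₀ (norm_nonneg _) hz
      _ = _ := one_mul _

theorem norm_pow_prime_pow_sub_one_le {p : ℕ} [Fact p.Prime] {K : Type*} [NormedField K]
    [NormedAlgebra ℚ_[p] K] [IsUltrametricDist K] {c : K} (n : ℕ)
    (hc : ‖c - 1‖ ≤ (p : ℝ) ^ (-((p : ℝ) ^ (-(n : ℝ))))) :
    ‖c ^ p ^ n - 1‖ ≤ (p : ℝ)⁻¹ := by
  have hp := (Fact.out : p.Prime)
  have hp0 : (0 : ℝ) < p := by exact_mod_cast hp.pos
  have hp1 : (1 : ℝ) ≤ p := by exact_mod_cast hp.one_le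
  induction n generalizing c with
  | zero => simpa [Real.rpow_neg_one] using hc
  | succ n ih =>
    rw [pow_succ', pow_mul]
    refine ih ?_
    have h1 : ‖c - 1‖ ≤ 1 := hc.trans (Real.rpow_le_one_of_one_le_of_nonpos hp1 (by
      rw [neg_nonpos]; positivity))
    have h2 := norm_pow_prime_sub_one_le (p := p) (c - 1) h1
    rw [add_sub_cancel] at h2
    refine h2.trans (max_le ?_ ?_)
    · rw [← Real.rpow_neg_one]
      refine Real.rpow_le_rpow_of_exponent_le hp1 (neg_le_neg ?_)
      exact Real.rpow_le_one_of_one_le_of_nonpos hp1 (by simp)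
    · refine (pow_le_pow_left₀ (norm_nonneg _) hc p).trans (le_of_eq ?_)
      rw [← Real.rpow_natCast, ← Real.rpow_mul hp0.le]
      congr 1
      push_cast
      rw [neg_add, Real.rpow_add hp0, Real.rpow_neg_one]
      field_simp

/-- A continuous function on `ℤ_[p]` with `f ((q ^ m - 1) / p ^ n) = d ^ m`, where `q - 1` has
exact order `n ≥ 1` and `d ≡ 1` modulo `p`, is given by a single power series. -/
theorem exists_hasSum_of_interpolates_pow {p : ℕ} [Fact p.Prime] (hodd : p ≠ 2) {n : ℕ}
    (hn : 1 ≤ n) {K : Type*} [NormedField K] [NormedAlgebra ℚ_[p] K] [CompleteSpace K]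
    [IsUltrametricDist K] {q : ℤ_[p]} (hq : ‖q - 1‖ = (p : ℝ)⁻¹ ^ n) {a : ℕ → ℤ_[p]}
    (ha : ∀ m, q ^ m = 1 + p ^ n * a m) {d : K} (hd : ‖d - 1‖ ≤ (p : ℝ)⁻¹) {f : ℤ_[p] → K}
    (hf : Continuous f) (hfa : ∀ m, f (a m) = d ^ m) :
    ∃ c : ℕ → K, ∀ x : ℤ_[p], HasSum (fun i : ℕ => (x : ℚ_[p]) ^ i • c i) (f x) := by
  have hp := (Fact.out : p.Prime)
  have hp0 : (0 : ℝ) < p := by exact_mod_cast hp.pos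
  have hr1 : (p : ℝ)⁻¹ < 1 := inv_lt_one_of_one_lt₀ (by exact_mod_cast hp.one_lt)
  have hqn : ‖q - 1‖ ≤ (p : ℝ)⁻¹ := by
    rw [hq]
    exact pow_le_of_le_one (by positivity) hr1.le (by omega)
  have hdvd : (p : ℤ_[p]) ∣ q - 1 := (PadicInt.norm_lt_one_iff_dvd _).1 (hqn.trans_lt hr1)
  have hqpow := PadicInt.norm_pow_sub_one hodd hdvd
  have hq1 : ‖q‖ = 1 := by
    have := IsUltrametricDist.norm_add_eq_max_of_norm_ne_norm (x := q - 1) (y := 1)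
      (by rw [norm_one]; exact (hqn.trans_lt hr1).ne)
    rwa [sub_add_cancel, norm_one, max_eq_right (hqn.trans hr1.le)] at this
  -- the interpolation nodes are isometrically indexed
  have hpn : ‖(p : ℤ_[p]) ^ n‖ = (p : ℝ)⁻¹ ^ n := by rw [norm_pow, PadicInt.norm_p]
  have hiso_le (i k : ℕ) : ‖a (i + k) - a i‖ = ‖(k : ℤ_[p])‖ := by
    have h1 : (p : ℤ_[p]) ^ n * (a (i + k) - a i) = q ^ i * (q ^ k - 1) := by
      rw [mul_sub, mul_sub, ← pow_add, ha, ha]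
      ring
    have h2 := congrArg norm h1
    rw [norm_mul, norm_mul, norm_pow q, hq1, one_pow, one_mul, hqpow, hq, hpn] at h2
    exact mul_left_cancel₀ (by positivity) h2
  have hiso (i j : ℕ) : ‖a i - a j‖ = ‖(i : ℤ_[p]) - j‖ := by
    rcases le_total i j with h | h
    · obtain ⟨k, rfl⟩ := Nat.exists_eq_add_of_le h
      rw [norm_sub_rev, hiso_le, norm_sub_rev]
      simp
    · obtain ⟨k, rfl⟩ := Nat.exists_eq_add_of_le h
      rw [hiso_le]
      simp
  have hdense := PadicInt.denseRange_of_norm_sub_eq hiso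
  let φ : ℤ_[p] →+* K := (algebraMap ℚ_[p] K).comp PadicInt.Coe.ringHom
  have hφ (x : ℤ_[p]) : ‖φ x‖ = ‖x‖ := norm_algebraMap' K (x : ℚ_[p])
  have hφinj : Function.Injective φ := (RingHom.injective_iff_ker_eq_bot φ).2 (by
    rw [RingHom.ker_eq_bot_iff_eq_zero]
    intro x hx
    rw [← norm_eq_zero, ← hφ, hx, norm_zero])
  have hq0 : φ q ≠ 0 := by rw [← norm_ne_zero_iff, hφ, hq1]; exact one_ne_zero
  have hqne (i : ℕ) : φ q ^ (i + 1) ≠ 1 := by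
    rw [← sub_ne_zero, ← map_pow, ← map_one φ, ← map_sub, ← norm_ne_zero_iff, hφ, hqpow, hq]
    refine mul_ne_zero (by positivity) ?_
    rw [norm_ne_zero_iff]
    exact_mod_cast Nat.succ_ne_zero i
  let b : ℕ → K := fun k => ∏ i ∈ Finset.range k,
    ((d - φ q ^ i) / ((φ q ^ (i + 1) - 1) * φ q ^ i) * φ (p ^ n))
  let Q : ℕ → Polynomial ℤ_[p] := fun k =>
    ∏ i ∈ Finset.range k, (Polynomial.X - Polynomial.C (a i))
  have hQ (k : ℕ) : (Q k).natDegree ≤ k := by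
    simp [Q, Polynomial.natDegree_prod_of_monic _ _ fun i _ => Polynomial.monic_X_sub_C (a i)]
  have hb' (k : ℕ) : ‖b k‖ ≤ ‖(k.factorial : ℚ_[p])‖⁻¹ * (p : ℝ)⁻¹ ^ k := by
    induction k with
    | zero => simp [b]
    | succ k ih =>
      have h1 : ‖d - φ q ^ k‖ ≤ (p : ℝ)⁻¹ := by
        have h2 : ‖φ q ^ k - 1‖ ≤ (p : ℝ)⁻¹ := by
          rw [← map_pow, ← map_one φ, ← map_sub, hφ, hqpow]
          exact (mul_le_of_le_one_right (norm_nonneg _) (PadicInt.norm_le_one _)).trans hqn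
        have h3 : d - φ q ^ k = (d - 1) + -(φ q ^ k - 1) := by ring
        rw [h3]
        exact (IsUltrametricDist.norm_add_le_max _ _).trans (max_le hd ((norm_neg _).trans_le h2))
      have h2 : ‖φ q ^ (k + 1) - 1‖ = (p : ℝ)⁻¹ ^ n * ‖((k + 1 : ℕ) : ℚ_[p])‖ := by
        rw [← map_pow, ← map_one φ, ← map_sub, hφ, hqpow, hq, PadicInt.norm_def]
        simp
      have h3 : ‖φ q ^ k‖ = 1 := by rw [norm_pow, hφ, hq1, one_pow]
      have h4 : b (k + 1) = b k *
        ((d - φ q ^ k) / ((φ q ^ (k + 1) - 1) * φ q ^ k) * φ (p ^ n)) := Finset.prod_range_succ _ _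
      have h5 : 0 < (p : ℝ)⁻¹ ^ n := by positivity
      rw [h4, norm_mul, norm_mul, norm_div, norm_mul, h3, h2, hφ, hpn, Nat.factorial_succ,
        Nat.cast_mul, norm_mul, mul_one, pow_succ]
      calc _ ≤ (‖(k.factorial : ℚ_[p])‖⁻¹ * (p : ℝ)⁻¹ ^ k) *
            ((p : ℝ)⁻¹ / ((p : ℝ)⁻¹ ^ n * ‖((k + 1 : ℕ) : ℚ_[p])‖) * (p : ℝ)⁻¹ ^ n) := by gcongr
        _ = _ := by
          rw [mul_comm ((p : ℝ)⁻¹ ^ n), ← div_div, div_mul_cancel₀ _ h5.ne', mul_inv, div_eq_mul_inv]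
          ring
  have hb (k : ℕ) : ‖b k‖ ≤ (p : ℝ)⁻¹ ^ (k / 2) :=
    (hb' k).trans (padicNorm_factorial_inv_mul_le_half p hodd k)
  have hu := summable_pow_half (r := (p : ℝ)⁻¹) (by positivity) hr1
  have hbound (k : ℕ) (x : ℤ_[p]) :
      ‖(((Q k).eval x : ℤ_[p]) : ℚ_[p]) • b k‖ ≤ (p : ℝ)⁻¹ ^ (k / 2) := by
    rw [norm_smul]
    exact (mul_le_of_le_one_left (norm_nonneg _) (PadicInt.norm_le_one _)).trans (hb k)
  let F : ℤ_[p] → K := fun x => ∑' k, (((Q k).eval x : ℤ_[p]) : ℚ_[p]) • b k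
  have hF : Continuous F := continuous_tsum
    (fun k => (continuous_subtype_val.comp (Q k).continuous).smul continuous_const) hu hbound
  have hFa (m : ℕ) : F (a m) = d ^ m := by
    rw [← (hasSum_qNewton hq0 hqne d m).tsum_eq]
    refine tsum_congr fun k => ?_
    have h1 : φ ((Q k).eval (a m)) * φ (p ^ n) ^ k =
        ∏ i ∈ Finset.range k, (φ q ^ m - φ q ^ i) := by
      rw [← map_pow, ← map_mul]
      simp only [Q, Polynomial.eval_prod, Polynomial.eval_sub, Polynomial.eval_X,
        Polynomial.eval_C]
      rw [← Finset.card_range k, ← Finset.prod_const, Finset.card_range, ← Finset.prod_mul_distrib,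
        map_prod]
      refine Finset.prod_congr rfl fun i _ => ?_
      rw [← map_pow, ← map_pow, ← map_sub, ha, ha]
      congr 1
      ring
    rw [← h1, Algebra.smul_def]
    change φ _ * _ = _
    simp only [b, Finset.prod_mul_distrib, Finset.prod_const, Finset.card_range]
    ring
  have hfF : f = F := hdense.equalizer hf hF (funext fun m => by simp [hfa, hFa])
  obtain ⟨c, hc⟩ := exists_hasSum_pow_smul
    (squeeze_zero (fun _ => norm_nonneg _) hb hu.tendsto_atTop_zero) hQ
  exact ⟨c, fun x => hc x _ (hfF ▸ (Summable.of_norm_bounded hu fun k => hbound k x).hasSum)⟩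

/-- Let `p` be odd and `n ≥ 1`.  For any function `φ` on `1+pℤ_p` constant on cosets of
`1+p^nℤ_p` and any continuous character `κ : 1+pℤ_p → K^×` (values in a complete
nonarchimedean extension of `ℚ_p`) with `|κ(exp(p)) − 1| ≤ p^{−p^{−n+1}}`, the product
`φ·κ` is analytic on each disk `exp(jp) + p^nℤ_p` (`0 ≤ j < p^{n-1}`), i.e. it is given
there by a single convergent power series; in particular `κ` itself is analytic on
`1+p^nℤ_p`. -/
theorem locally_constant_mul_character_analytic (p n : ℕ) [Fact p.Prime] (hodd : p ≠ 2)
    (hn : 1 ≤ n) (K : Type*) [NontriviallyNormedField K] [NormedAlgebra ℚ_[p] K]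
    [CompleteSpace K] [IsUltrametricDist K] (κ φ : ℚ_[p] → K)
    (hκcont : ContinuousOn κ {x : ℚ_[p] | ‖x - 1‖ ≤ ((p : ℝ))⁻¹})
    (hκmul : ∀ x y : ℚ_[p], ‖x - 1‖ ≤ ((p : ℝ))⁻¹ → ‖y - 1‖ ≤ ((p : ℝ))⁻¹ →
      κ (x * y) = κ x * κ y)
    (hκnorm : ‖κ (padicExp (p : ℚ_[p])) - 1‖ ≤ (p : ℝ) ^ (-((p : ℝ) ^ ((1 : ℝ) - (n : ℝ)))))
    (hφ : ∀ x y : ℚ_[p], ‖x - 1‖ ≤ ((p : ℝ))⁻¹ → ‖y - x‖ ≤ (p : ℝ) ^ (-(n : ℤ)) →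
      φ x = φ y) :
    (∀ j : ℕ, j < p ^ (n - 1) → ∃ c : ℕ → K, ∀ x : ℚ_[p], ‖x‖ ≤ 1 →
        HasSum (fun i : ℕ => x ^ i • c i)
          (φ (padicExp ((j : ℚ_[p]) * (p : ℚ_[p])) + (p : ℚ_[p]) ^ n * x) *
            κ (padicExp ((j : ℚ_[p]) * (p : ℚ_[p])) + (p : ℚ_[p]) ^ n * x))) ∧
    (∃ c : ℕ → K, ∀ x : ℚ_[p], ‖x‖ ≤ 1 →
        HasSum (fun i : ℕ => x ^ i • c i) (κ (1 + (p : ℚ_[p]) ^ n * x))) := by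
  have hp := (Fact.out : p.Prime)
  have hp0 : (0 : ℝ) < p := by exact_mod_cast hp.pos
  have hp1 : (1 : ℝ) < p := by exact_mod_cast hp.one_lt
  have hr1 : (p : ℝ)⁻¹ < 1 := inv_lt_one_of_one_lt₀ hp1
  have hr2 : (p : ℝ)⁻¹ ^ 2 < (p : ℝ)⁻¹ := pow_lt_self_of_lt_one₀ (by positivity) hr1 (by norm_num)
  have hpn (x : ℚ_[p]) (hx : ‖x‖ ≤ 1) : ‖(p : ℚ_[p]) ^ n * x‖ ≤ (p : ℝ)⁻¹ ^ n := by
    rw [norm_mul, norm_pow, Padic.norm_p]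
    exact mul_le_of_le_one_right (by positivity) hx
  have hrn : (p : ℝ)⁻¹ ^ n ≤ (p : ℝ)⁻¹ := pow_le_of_le_one (by positivity) hr1.le (by omega)
  have hexp (x : ℚ_[p]) (hx : ‖x‖ ≤ (p : ℝ)⁻¹) : ‖padicExp x - 1‖ ≤ (p : ℝ)⁻¹ := by
    have h := norm_padicExp_sub_le hodd hx
    rw [← sub_add_cancel (padicExp x - 1) x]
    exact (IsUltrametricDist.norm_add_le_max _ _).trans (max_le (h.trans hr2.le) hx)
  set e : ℚ_[p] := padicExp (p : ℚ_[p])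
  have he1 : ‖e - 1‖ = (p : ℝ)⁻¹ := by
    have h := norm_padicExp_sub_le hodd (x := (p : ℚ_[p])) Padic.norm_p.le
    have := IsUltrametricDist.norm_add_eq_max_of_norm_ne_norm (x := e - 1 - p)
      (y := (p : ℚ_[p])) (by rw [Padic.norm_p]; exact (h.trans_lt hr2).ne)
    rwa [sub_add_cancel, Padic.norm_p, max_eq_right (h.trans hr2.le)] at this
  have norm_one_of (x : ℚ_[p]) (hx : ‖x - 1‖ ≤ (p : ℝ)⁻¹) : ‖x‖ = 1 := by
    have := IsUltrametricDist.norm_add_eq_max_of_norm_ne_norm (x := x - 1) (y := 1)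
      (by rw [norm_one]; exact (hx.trans_lt hr1).ne)
    rwa [sub_add_cancel, norm_one, max_eq_right (hx.trans hr1.le)] at this
  have hpow (x : ℚ_[p]) (hx : ‖x - 1‖ ≤ (p : ℝ)⁻¹) (m : ℕ) : ‖x ^ m - 1‖ ≤ (p : ℝ)⁻¹ := by
    rw [← mul_geom_sum, norm_mul]
    refine (mul_le_of_le_one_right (norm_nonneg _) ?_).trans hx
    refine IsUltrametricDist.norm_sum_le_of_forall_le_of_nonneg zero_le_one fun i _ => ?_
    rw [norm_pow, norm_one_of x hx, one_pow]
  have hκ1 : κ 1 = 1 := by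
    have h1 := hκmul 1 e (by simp) he1.le
    rw [one_mul] at h1
    refine mul_right_cancel₀ (b := κ e) (fun h0 => ?_) (by rw [← h1, one_mul])
    rw [h0, zero_sub, norm_neg, norm_one] at hκnorm
    refine absurd hκnorm (not_le.2 (Real.rpow_lt_one_of_one_lt_of_neg hp1 ?_))
    rw [neg_lt_zero]
    positivity
  have hκpow (x : ℚ_[p]) (hx : ‖x - 1‖ ≤ (p : ℝ)⁻¹) (m : ℕ) : κ (x ^ m) = κ x ^ m := by
    induction m with
    | zero => simp [hκ1]
    | succ m ih => rw [pow_succ, hκmul _ _ (hpow x hx m) hx, ih, pow_succ]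
  let E : ℤ_[p] := ⟨e, (norm_one_of e he1.le).le⟩
  have hE1 : ‖E - 1‖ = (p : ℝ)⁻¹ := he1
  have hEq : ‖E ^ p ^ (n - 1) - 1‖ = (p : ℝ)⁻¹ ^ n := by
    rw [PadicInt.norm_pow_sub_one hodd ((PadicInt.norm_lt_one_iff_dvd _).1 (hE1 ▸ hr1)), hE1,
      Nat.cast_pow, norm_pow, PadicInt.norm_p, ← pow_succ', Nat.sub_add_cancel hn]
  have hd : ‖κ e ^ p ^ (n - 1) - 1‖ ≤ (p : ℝ)⁻¹ := by
    refine norm_pow_prime_pow_sub_one_le (n - 1) ?_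
    rwa [Nat.cast_sub hn, Nat.cast_one, neg_sub]
  have hdvd (m : ℕ) : ∃ a : ℤ_[p], (E ^ p ^ (n - 1)) ^ m = 1 + p ^ n * a := by
    have h1 : (p : ℤ_[p]) ^ n ∣ E ^ p ^ (n - 1) - 1 := by
      rw [← Ideal.mem_span_singleton, ← PadicInt.norm_le_pow_iff_mem_span_pow, hEq]
      simp
    obtain ⟨a, ha⟩ := h1.trans (sub_one_dvd_pow_sub_one _ m)
    exact ⟨a, by rw [← ha]; ring⟩
  choose a ha using hdvd
  have hmem (x : ℤ_[p]) : ‖(1 + (p : ℚ_[p]) ^ n * x) - 1‖ ≤ (p : ℝ)⁻¹ := by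
    rw [add_sub_cancel_left]
    exact (hpn x (PadicInt.norm_le_one x)).trans hrn
  have hcont : Continuous fun x : ℤ_[p] => κ (1 + (p : ℚ_[p]) ^ n * x) :=
    hκcont.comp_continuous (by fun_prop) hmem
  obtain ⟨c, hc⟩ := exists_hasSum_of_interpolates_pow hodd hn hEq ha hd hcont fun m => by
    have h1 := congrArg (fun x : ℤ_[p] => (x : ℚ_[p])) (ha m)
    push_cast at h1
    rw [← h1, hκpow _ (hpow e he1.le _), hκpow _ he1.le]
  have hc' (x : ℚ_[p]) (hx : ‖x‖ ≤ 1) :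
      HasSum (fun i : ℕ => x ^ i • c i) (κ (1 + (p : ℚ_[p]) ^ n * x)) := hc ⟨x, hx⟩
  refine ⟨fun j _ => ?_, c, hc'⟩
  set u : ℚ_[p] := padicExp ((j : ℚ_[p]) * (p : ℚ_[p]))
  have hu1 : ‖u - 1‖ ≤ (p : ℝ)⁻¹ := hexp _ (by
    rw [norm_mul, Padic.norm_p]
    exact mul_le_of_le_one_left (by positivity) (IsUltrametricDist.norm_natCast_le_one _ j))
  have hun := norm_one_of u hu1
  have hu0 : u ≠ 0 := by rw [← norm_ne_zero_iff, hun]; exact one_ne_zero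
  refine ⟨fun i => (u⁻¹) ^ i • (φ u * κ u * c i), fun x hx => ?_⟩
  have hx' : ‖u⁻¹ * x‖ ≤ 1 := by rwa [norm_mul, norm_inv, hun, inv_one, one_mul]
  have h1 : φ (u + p ^ n * x) = φ u := (hφ u _ hu1 (by
    rw [add_sub_cancel_left]
    simpa using hpn x hx)).symm
  have h2 : κ (u + p ^ n * x) = κ u * κ (1 + p ^ n * (u⁻¹ * x)) := by
    rw [← hκmul _ _ hu1 (hmem ⟨_, hx'⟩)]
    congr 1
    field_simp
  rw [h1, h2, ← mul_assoc]
  refine ((hc' _ hx').mul_left (φ u * κ u)).congr_fun fun i => ?_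
  rw [mul_smul_comm, smul_smul, mul_pow, mul_comm (x ^ i)]
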